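/- For every integer n ≥ 1, every x > 0, and every integer k with 1 ≤ k ≤ n-1, the error in the Gaussian tail upper bound satisfies (h_n(x)/g_n(x)) exp(-x²/2) - ∫_x^∞ exp(-t²/2) dt < √(2π) (2k+1)! (2(n-k)-1)! n! / (2^k x^{2(k+1)} (2n)! (n-k-1)!). -/

import Mathlib

open Nat Finset MeasureTheory Real

noncomputable def gp (n : ℕ) (x : ℝ) : ℝ :=
  ∑ i ∈ Finset.range (n+1), ((2*n+1)! : ℝ) / ((2*(n-i))‼ * (2*i+1)!) * x^(2*i+1)

noncomputable def hp (n : ℕ) (x : ℝ) : ℝ :=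
  ∑ i ∈ Finset.range (n+1), ((n+i)! * (n-i)! : ℝ) / ((2*(n-i))‼ * (2*i)!) *
    (∑ j ∈ Finset.range (n-i+1), ((2*n+1).choose j : ℝ)) * x^(2*i)

lemma P_bound (m : ℕ) : ((4:ℝ)^(m+1) * ((m+1)! : ℝ)^2 / ((2*(m+1))! : ℝ))^2 ≤ (16*((m:ℝ)+1)+4)/5 := by
  induction m with
  | zero => norm_num [Nat.factorial]
  | succ m ih =>
    have h1 : ((2*(m+1+1))! : ℝ) = (2*(m:ℝ)+4)*(2*m+3)*((2*(m+1))! : ℝ) := by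
      rw [show 2*(m+1+1) = (2*(m+1)+1)+1 by ring, Nat.factorial_succ, Nat.factorial_succ]
      push_cast; ring
    have h2 : ((m+1+1)! : ℝ) = ((m:ℝ)+2) * ((m+1)! : ℝ) := by
      rw [Nat.factorial_succ]; push_cast; ring
    have hp : (0:ℝ) < ((2*(m+1))! : ℝ) := by positivity
    have hm : (0:ℝ) ≤ m := by positivity
    have key : (4:ℝ)^(m+1+1) * ((m+1+1)! : ℝ)^2 / ((2*(m+1+1))! : ℝ) =
      ((4:ℝ)^(m+1) * ((m+1)! : ℝ)^2 / ((2*(m+1))! : ℝ)) * ((2*(m:ℝ)+4)/(2*m+3)) := by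
      rw [h1, h2]; field_simp; ring
    rw [key, mul_pow]
    calc _ ≤ (16*((m:ℝ)+1)+4)/5 * ((2*(m:ℝ)+4)/(2*m+3))^2 := by gcongr
      _ ≤ _ := by
        rw [div_pow, _root_.div_mul_div_comm, div_le_div_iff₀ (by positivity) (by positivity)]
        push_cast
        nlinarith [hm]

lemma poly_ineq (k m P : ℝ) (hk : 1 ≤ k) (hm : 1 ≤ m) (hP : P^2 ≤ (16*m+4)/5) :
    (k+1)*P ≤ (1 + (2*k+1)*(k-1)/(8*(m+k)))*(2*(m+k)+1) := by
  have h1 : (k+1)*P ≤ 3/5*((16*m+4)/5) + (k+1)^2*(5/12) := by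
    nlinarith [sq_nonneg (3/5*P - (k+1)/2)]
  refine h1.trans ?_
  have hmk : 0 < 8*(m+k) := by linarith
  have : (1 + (2*k+1)*(k-1)/(8*(m+k)))*(2*(m+k)+1) = (8*(m+k) + (2*k+1)*(k-1))*(2*(m+k)+1)/(8*(m+k)) := by
    field_simp
  rw [this, le_div_iff₀ hmk]
  obtain ⟨a, rfl⟩ : ∃ a, k = a + 1 := ⟨k-1, by ring⟩
  obtain ⟨b, rfl⟩ : ∃ b, m = b + 1 := ⟨m-1, by ring⟩
  have ha : 0 ≤ a := by linarith
  have hb : 0 ≤ b := by linarith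
  rw [← sub_nonneg]
  ring_nf
  positivity

lemma sum_pairs (f : ℕ → ℝ) (k : ℕ) : ∑ i ∈ range (k+1), (f (2*i) + f (2*i+1)) = ∑ j ∈ range (2*k+2), f j := by
  induction k with
  | zero => simp [Finset.sum_range_succ]
  | succ k ih => rw [Finset.sum_range_succ, ih, show 2*(k+1)+2 = 2*k+2+1+1 by ring,
      Finset.sum_range_succ _ (2*k+2+1), Finset.sum_range_succ _ (2*k+2)]
                 rw [show 2*(k+1) = 2*k+2 by ring]; ring

lemma full_sum (N : ℕ) : ∑ j ∈ range (N+1), ((N.choose j : ℕ) : ℝ) = 2^N := by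
  exact_mod_cast Nat.sum_range_choose N

lemma odd_sum (k : ℕ) : ∑ i ∈ range (k+1), (((2*k+2).choose (2*i+1) : ℕ) : ℝ) = 2*4^k := by
  have := sum_pairs (fun j => (((2*k+1).choose j : ℕ) : ℝ)) k
  rw [show 2*k+2 = (2*k+1)+1 by ring, full_sum] at this
  rw [show (2:ℝ)*4^k = 2^(2*k+1) by rw [pow_succ, pow_mul]; norm_num; ring, ← this]
  refine Finset.sum_congr rfl fun i _ => ?_
  rw [Nat.choose_succ_succ]; push_cast; ring

lemma even_sum (k : ℕ) : ∑ i ∈ range (k+2), (((2*k+2).choose (2*i) : ℕ) : ℝ) = 2*4^k := by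
  have := sum_pairs (fun j => (((2*k+1).choose (j+1) : ℕ) : ℝ)) k
  have h2 := full_sum (2*k+1)
  rw [Finset.sum_range_succ' _ (2*k+1)] at h2
  rw [Finset.sum_range_succ _ (2*k+1)] at this
  rw [show (2:ℝ)*4^k = 2^(2*k+1) by rw [pow_succ, pow_mul]; norm_num; ring, ← h2]
  rw [show (2*k+1).choose (2*k+1+1) = 0 from Nat.choose_eq_zero_of_lt (by omega)] at this
  simp only [Nat.cast_zero, add_zero] at this
  rw [Finset.sum_range_succ', ← this]
  congr 1
  refine Finset.sum_congr rfl fun i _ => ?_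
  rw [show 2*(i+1) = (2*i+1)+1 by ring, show 2*k+2 = (2*k+1)+1 by ring, Nat.choose_succ_succ]; push_cast; ring

lemma moment_sum (k : ℕ) : ∑ i ∈ range (k+2), ((i:ℝ)*((k:ℝ)+1-i)) * (((2*k+4).choose (2*i+1) : ℕ) : ℝ)
    = (2*k+3)*k*4^k := by
  have h1 := odd_sum (k+1)
  have h2 := even_sum k
  have key : ∀ i ∈ range (k+2), ((i:ℝ)*((k:ℝ)+1-i)) * (((2*k+4).choose (2*i+1) : ℕ) : ℝ)
      = (2*k+4)*(2*k+3)/4 * (((2*k+2).choose (2*i) : ℕ) : ℝ) - (2*k+3)/4 * (((2*(k+1)+2).choose (2*i+1) : ℕ) : ℝ) := by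
    intro i hi
    have hi : i ≤ k+1 := by simp at hi; omega
    obtain ⟨j, hj⟩ : ∃ j, k+1 = i + j := ⟨k+1-i, by omega⟩
    have e1 : (((2*k+4).choose (2*i+1) : ℕ) : ℝ) = ((2*k+4)! : ℝ)/((2*i+1)! * (2*j+1)!) := by
      rw [Nat.cast_choose ℝ (by omega), show 2*k+4-(2*i+1) = 2*j+1 by omega]
    have e2 : (((2*k+2).choose (2*i) : ℕ) : ℝ) = ((2*k+2)! : ℝ)/((2*i)! * (2*j)!) := by
      rw [Nat.cast_choose ℝ (by omega), show 2*k+2-(2*i) = 2*j by omega]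
    rw [show 2*(k+1)+2 = 2*k+4 by ring, e1, e2, show 2*k+4 = (2*k+2+1)+1 by ring]
    simp only [Nat.factorial_succ (2*i), Nat.factorial_succ (2*j), Nat.factorial_succ (2*k+2+1), Nat.factorial_succ (2*k+2)]
    have hk : (k:ℝ) = i + j - 1 := by
      have : ((k+1:ℕ):ℝ) = ((i+j:ℕ):ℝ) := by rw [hj]
      push_cast at this; linarith
    push_cast
    rw [hk]
    field_simp
    ring
  rw [Finset.sum_congr rfl key, Finset.sum_sub_distrib, ← Finset.mul_sum, ← Finset.mul_sum, h2, h1, pow_succ]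
  ring

lemma ratio_bound (m i j : ℕ) : (1 + (i:ℝ)*j/((m:ℝ)+i+j)) * ((m+j)! * (m+i)! : ℝ) ≤ (m+i+j)! * (m)! := by
  have gen : ∀ M : ℝ, (m:ℝ)+i ≤ M → 0 < M → (1 + (i:ℝ)*j/M) * ((m+j)! * (m+i)! : ℝ) ≤ (m+i+j)! * (m)! := by
    induction i with
    | zero => intro M _ _; simp
    | succ i ih =>
      intro M hM hM0
      push_cast at hM
      have := ih M (by linarith) hM0
      rw [show m+(i+1)+j = (m+i+j)+1 by ring, show m+(i+1) = m+i+1 by ring, Nat.factorial_succ (m+i+j), Nat.factorial_succ (m+i)]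
      push_cast
      have hF : (0:ℝ) < (m+j)! * (m+i)! := by positivity
      have hfac : (1 + ((i:ℝ)+1)*j/M) * ((m:ℝ)+i+1) ≤ ((m:ℝ)+i+j+1) * (1 + (i:ℝ)*j/M) := by
        have h3 : (j:ℝ)*((m:ℝ)+i+1)/M ≤ j := by
          rw [div_le_iff₀ hM0]; gcongr; linarith
        have h4 : (0:ℝ) ≤ j*(i*j/M) := by positivity
        have : (1 + ((i:ℝ)+1)*j/M) * ((m:ℝ)+i+1) = (1 + (i:ℝ)*j/M) * ((m:ℝ)+i+1) + (j:ℝ)*((m:ℝ)+i+1)/M := by ring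
        nlinarith
      calc _ = ((1 + ((i:ℝ)+1)*j/M) * ((m:ℝ)+i+1)) * ((m+j)! * (m+i)!) := by ring
        _ ≤ (((m:ℝ)+i+j+1) * (1 + (i:ℝ)*j/M)) * ((m+j)! * (m+i)!) := by gcongr
        _ = ((m:ℝ)+i+j+1) * ((1 + (i:ℝ)*j/M) * ((m+j)! * (m+i)!)) := by ring
        _ ≤ ((m:ℝ)+i+j+1) * ((m+i+j)! * (m)!) := by gcongr
        _ = _ := by ring
  rcases Nat.eq_zero_or_pos (m+i+j) with h | h
  · obtain ⟨rfl, rfl, rfl⟩ : m = 0 ∧ i = 0 ∧ j = 0 := by omega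
    simp
  · apply gen
    · have : (0:ℝ) ≤ j := by positivity
      linarith
    · exact_mod_cast h

noncomputable def gc (n i : ℕ) : ℝ := ((2*n+1)! : ℝ) / (2^(n-i) * (n-i)! * (2*i+1)!)
noncomputable def hc (n i : ℕ) : ℝ := ((n+i)! : ℝ) / (2^(n-i) * (2*i)!) *
    (∑ j ∈ Finset.range (n-i+1), ((2*n+1).choose j : ℝ))

lemma gp_eq (n : ℕ) (x : ℝ) : gp n x = ∑ i ∈ Finset.range (n+1), gc n i * x^(2*i+1) := by
  unfold gp gc
  refine Finset.sum_congr rfl fun i _ => ?_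
  rw [Nat.doubleFactorial_two_mul]; push_cast; rfl

lemma hp_eq (n : ℕ) (x : ℝ) : hp n x = ∑ i ∈ Finset.range (n+1), hc n i * x^(2*i) := by
  unfold hp hc
  refine Finset.sum_congr rfl fun i _ => ?_
  rw [Nat.doubleFactorial_two_mul]; push_cast
  congr 2
  field_simp

lemma gc_pos (n i : ℕ) : 0 < gc n i := by unfold gc; positivity

noncomputable def gd (n : ℕ) (x : ℝ) : ℝ := ∑ i ∈ Finset.range (n+1), gc n i * ((2*i+1) * x^(2*i))
noncomputable def gdd (n : ℕ) (x : ℝ) : ℝ := ∑ i ∈ Finset.range (n+1), gc n i * ((2*i+1) * ((2*i) * x^(2*i-1)))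
noncomputable def hd (n : ℕ) (x : ℝ) : ℝ := ∑ i ∈ Finset.range (n+1), hc n i * ((2*i) * x^(2*i-1))
noncomputable def hdd (n : ℕ) (x : ℝ) : ℝ := ∑ i ∈ Finset.range (n+1), hc n i * ((2*i) * (((2*i-1:ℕ):ℝ) * x^(2*i-1-1)))

lemma hasDeriv_g (n : ℕ) (x : ℝ) : HasDerivAt (gp n) (gd n x) x := by
  have : gp n = fun x => ∑ i ∈ Finset.range (n+1), gc n i * x^(2*i+1) := funext (gp_eq n)
  rw [this]
  refine HasDerivAt.fun_sum fun i _ => ?_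
  refine HasDerivAt.const_mul _ ?_
  exact (hasDerivAt_pow (2*i+1) x).congr_deriv (by push_cast; simp)

lemma hasDeriv_gd (n : ℕ) (x : ℝ) : HasDerivAt (gd n) (gdd n x) x := by
  refine HasDerivAt.fun_sum fun i _ => ?_
  refine HasDerivAt.const_mul _ (HasDerivAt.const_mul _ ?_)
  exact (hasDerivAt_pow (2*i) x).congr_deriv (by push_cast; simp)

lemma hasDeriv_h (n : ℕ) (x : ℝ) : HasDerivAt (hp n) (hd n x) x := by
  have : hp n = fun x => ∑ i ∈ Finset.range (n+1), hc n i * x^(2*i) := funext (hp_eq n)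
  rw [this]
  refine HasDerivAt.fun_sum fun i _ => ?_
  refine HasDerivAt.const_mul _ ?_
  exact (hasDerivAt_pow (2*i) x).congr_deriv (by push_cast; simp)

lemma hasDeriv_hd (n : ℕ) (x : ℝ) : HasDerivAt (hd n) (hdd n x) x := by
  refine HasDerivAt.fun_sum fun i _ => ?_
  refine HasDerivAt.const_mul _ (HasDerivAt.const_mul _ ?_)
  exact hasDerivAt_pow (2*i-1) x

lemma gc_rec (n i : ℕ) (hi : i < n) : gc n (i+1) * ((2*i+3)*(2*i+2)) = gc n i * (2*n - 2*i) := by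
  obtain ⟨j, rfl⟩ : ∃ j, n = i + j + 1 := ⟨n-i-1, by omega⟩
  unfold gc
  rw [show i+j+1-(i+1) = j by omega, show i+j+1-i = j+1 by omega, show 2*(i+1)+1 = 2*i+1+1+1 by ring]
  simp only [Nat.factorial_succ j, Nat.factorial_succ (2*i+1+1), Nat.factorial_succ (2*i+1), pow_succ]
  push_cast
  field_simp
  ring

lemma hc_rec (n i : ℕ) (hi : i < n) :
    hc n (i+1) * ((2*i+2)*(2*i+1)) = hc n i * (2*i+2*n+2) - 2*(2*i+1)*gc n i := by
  obtain ⟨j, rfl⟩ : ∃ j, n = i + j + 1 := ⟨n-i-1, by omega⟩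
  unfold gc hc
  rw [show i+j+1-(i+1) = j by omega, show i+j+1-i = j+1 by omega, show 2*(i+1) = 2*i+1+1 by ring,
    Finset.sum_range_succ _ (j+1), Nat.cast_choose ℝ (show j+1 ≤ 2*(i+j+1)+1 by omega),
    show 2*(i+j+1)+1-(j+1) = i+j+1+i+1 by omega, show i+j+1+(i+1) = i+j+1+i+1 by omega]
  simp only [Nat.factorial_succ (i+j+1+i), Nat.factorial_succ (2*i+1), Nat.factorial_succ (2*i), pow_succ]
  push_cast
  field_simp
  ring

lemma g_ode (n : ℕ) (x : ℝ) : gdd n x + x * gd n x = (2*n+1) * gp n x := by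
  rw [gp_eq]
  unfold gdd gd
  rw [Finset.sum_range_succ', Finset.mul_sum, Finset.mul_sum]
  have e : ∑ i ∈ range n, gc n (i+1) * ((2*((i+1:ℕ):ℝ)+1) * ((2*((i+1:ℕ):ℝ)) * x^(2*(i+1)-1)))
     = ∑ i ∈ range n, gc n i * (2*n-2*i) * x^(2*i+1) := by
    refine Finset.sum_congr rfl fun i hi => ?_
    rw [← gc_rec n i (by simpa using hi), show 2*(i+1)-1 = 2*i+1 by omega]
    push_cast; ring
  have e2 : ∑ i ∈ range (n+1), gc n i * (2*n-2*i) * x^(2*i+1) = ∑ i ∈ range n, gc n i * (2*n-2*i) * x^(2*i+1) := by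
    rw [Finset.sum_range_succ]; ring
  rw [e, ← e2]
  simp only [Nat.cast_zero, mul_zero, zero_mul, add_zero]
  rw [← Finset.sum_add_distrib]
  refine Finset.sum_congr rfl fun i hi => ?_
  ring

lemma h_ode (n : ℕ) (x : ℝ) : hdd n x - x * hd n x - (2*n+2) * hp n x = -2 * gd n x := by
  rw [hp_eq]
  unfold hdd hd gd
  rw [Finset.sum_range_succ', Finset.mul_sum, Finset.mul_sum, Finset.mul_sum]
  have e : ∑ i ∈ range n, hc n (i+1) * ((2*((i+1:ℕ):ℝ)) * (((2*(i+1)-1:ℕ):ℝ) * x^(2*(i+1)-1-1)))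
     = ∑ i ∈ range n, (hc n i * (2*i+2*n+2) - 2*(2*i+1)*gc n i) * x^(2*i) := by
    refine Finset.sum_congr rfl fun i hi => ?_
    rw [← hc_rec n i (by simpa using hi), show 2*(i+1)-1 = 2*i+1 by omega]
    rw [Nat.add_sub_cancel]; push_cast; ring
  have e2 : ∑ i ∈ range (n+1), (hc n i * (2*i+2*n+2) - 2*(2*i+1)*gc n i) * x^(2*i) = ∑ i ∈ range n, (hc n i * (2*i+2*n+2) - 2*(2*i+1)*gc n i) * x^(2*i) := by
    rw [Finset.sum_range_succ]
    have : hc n n = 1 := by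
      unfold hc; simp [← two_mul, Nat.factorial_ne_zero]
    have h' : gc n n = 1 := by
      unfold gc; simp [Nat.factorial_ne_zero]
    rw [this, h']; ring
  rw [e, ← e2]
  simp only [Nat.cast_zero, mul_zero, zero_mul, add_zero]
  rw [← Finset.sum_sub_distrib, ← Finset.sum_sub_distrib]
  refine Finset.sum_congr rfl fun i hi => ?_
  rcases i with _ | i
  · simp; ring
  · rw [show 2*(i+1)-1 = 2*i+1 by omega, show 2*(i+1) = 2*i+1+1 by omega]
    push_cast; ring

lemma wronsk (n : ℕ) (x : ℝ) :
    gp n x^2 + hd n x * gp n x - hp n x * gd n x - x * hp n x * gp n x = -((2*n+1)! : ℝ) := by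
  let W : ℝ → ℝ := fun x => gp n x^2 + hd n x * gp n x - hp n x * gd n x - x * hp n x * gp n x
  have hW : ∀ y, HasDerivAt W 0 y := by
    intro y
    have hg := hasDeriv_g n y
    have hg' := hasDeriv_gd n y
    have hh := hasDeriv_h n y
    have hh' := hasDeriv_hd n y
    have := (((hg.fun_pow 2).fun_add (hh'.fun_mul hg)).fun_sub (hh.fun_mul hg')).fun_sub (((hasDerivAt_id' y).fun_mul hh).fun_mul hg)
    refine this.congr_deriv ?_
    have o1 := g_ode n y
    have o2 := h_ode n y
    have o1 : gdd n y = (2*n+1) * gp n y - y * gd n y := by linarith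
    have o2 : hdd n y = -2*gd n y + y * hd n y + (2*n+2) * hp n y := by linarith
    rw [o1, o2]; simp; ring
  have hc0 : W x = W 0 := is_const_of_deriv_eq_zero (fun y => (hW y).differentiableAt) (fun y => (hW y).deriv) x 0
  have e0 : W 0 = -((2*n+1)! : ℝ) := by
    have g0 : gp n 0 = 0 := by rw [gp_eq]; simp
    have h0 : hp n 0 = hc n 0 := by rw [hp_eq, Finset.sum_range_succ']; simp
    have gd0 : gd n 0 = gc n 0 := by unfold gd; rw [Finset.sum_range_succ']; simp
    simp only [W, g0, h0, gd0]
    have := Nat.sum_range_choose_halfway n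
    have : ∑ j ∈ Finset.range (n+1), ((2*n+1).choose j : ℝ) = 4^n := by exact_mod_cast this
    unfold hc gc
    simp only [Nat.sub_zero, add_zero, mul_zero, zero_add, this]
    rw [show (4:ℝ)^n = 2^n*2^n by rw [← mul_pow]; norm_num]
    simp
    field_simp
  rw [← e0, ← hc0]

lemma gp_lower (n : ℕ) (x : ℝ) (hx : 0 < x) (i : ℕ) (hi : i ≤ n) (hn : 1 ≤ n) : gc n i * x^(2*i+1) < gp n x := by
  rw [gp_eq]
  obtain ⟨j, hj, hne⟩ : ∃ j, j ≤ n ∧ j ≠ i := by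
    rcases i with _ | i
    · exact ⟨1, hn, by omega⟩
    · exact ⟨0, by omega, by omega⟩
  refine Finset.single_lt_sum (f := fun i => gc n i * x^(2*i+1)) hne (by simp; omega) (by simp; omega) ?_ ?_
  · have := gc_pos n j; positivity
  · intro k _ _; have := gc_pos n k; positivity

lemma gp_pos (n : ℕ) (x : ℝ) (hx : 0 < x) : 0 < gp n x := by
  rw [gp_eq]
  refine Finset.sum_pos (fun i _ => ?_) (by simp)
  have := gc_pos n i; positivity

lemma gp_mono (n : ℕ) (x y : ℝ) (hx : 0 < x) (hxy : x ≤ y) : gp n x ≤ gp n y := by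
  rw [gp_eq, gp_eq]
  refine Finset.sum_le_sum (fun i _ => ?_)
  have := gc_pos n i; gcongr

lemma gp_sq (n : ℕ) (hn : 1 ≤ n) (x : ℝ) (hx : 0 < x) (k : ℕ) (hk : k ≤ n) :
    (∑ i ∈ range (k+1), gc n i * gc n (k-i)) * x^(2*(k+1)) < gp n x^2 := by
  have hg := gp_pos n x hx
  have step : (∑ i ∈ range (k+1), gc n i * gc n (k-i)) * x^(2*(k+1))
      < ∑ i ∈ range (k+1), gc n i * x^(2*i+1) * gp n x := by
    rw [Finset.sum_mul]
    refine Finset.sum_lt_sum_of_nonempty (by simp) fun i hi => ?_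
    have hi : i ≤ k := by simp at hi; omega
    have e : x^(2*(k+1)) = x^(2*i+1) * x^(2*(k-i)+1) := by
      rw [← pow_add]; congr 1; omega
    have l := gp_lower n x hx (k-i) (by omega) hn
    have := gc_pos n i
    calc _ = gc n i * x^(2*i+1) * (gc n (k-i) * x^(2*(k-i)+1)) := by rw [e]; ring
      _ < _ := by gcongr
  refine step.trans_le ?_
  rw [← Finset.sum_mul, sq]
  gcongr
  rw [gp_eq]
  refine Finset.sum_le_sum_of_subset_of_nonneg (by simp; omega) fun i _ _ => ?_
  have := gc_pos n i; positivity

lemma coef_bound (k m : ℕ) :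
    ((2*(m+1+(k+1))+1)! : ℝ) * 2^(k+1) * (2*(m+1+(k+1)))! * (m+1)! / ((2*(k+1)+1)! * (m+1+(k+1))! * (2*(m+1))!)
      ≤ ∑ i ∈ range (k+2), gc (m+1+(k+1)) i * gc (m+1+(k+1)) (k+1-i) := by
  set n := m+1+(k+1) with hn
  set C : ℝ := ((2*n+1)! : ℝ)^2 / (2^(2*m+k+3) * n ! * (m+1)! * (2*k+4)!) with hC
  have hC0 : 0 < C := by positivity
  have term : ∀ i ∈ range (k+2), C * ((1 + ((i:ℝ)*((k:ℝ)+1-i))/n) * (((2*k+4).choose (2*i+1) : ℕ) : ℝ))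
      ≤ gc n i * gc n (k+1-i) := by
    intro i hi
    have hi : i ≤ k+1 := by simp at hi; omega
    obtain ⟨j, hj⟩ : ∃ j, k+1 = i + j := ⟨k+1-i, by omega⟩
    have hk : (k:ℝ) + 1 - i = j := by
      have : ((k+1:ℕ):ℝ) = ((i+j:ℕ):ℝ) := by rw [hj]
      push_cast at this; linarith
    have hr := ratio_bound (m+1) i j
    have hnn : n = m+1+i+j := by omega
    have hnr : (n:ℝ) = ((m+1:ℕ):ℝ)+i+j := by rw [hnn]; push_cast; ring
    rw [← hnr, ← hnn] at hr
    unfold gc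
    rw [hk, show k+1-i = j by omega, show n - i = m+1+j by omega, show n-j = m+1+i by omega,
      Nat.cast_choose ℝ (by omega), show 2*k+4-(2*i+1) = 2*j+1 by omega, hC,
      show 2*m+k+3 = (m+1+j)+(m+1+i) by omega, pow_add]
    set E : ℝ := 1 + (i:ℝ)*j/n
    have q : E / ((n ! : ℝ) * (m+1)!) ≤ 1 / ((m+1+j)! * (m+1+i)!) := by
      rw [div_le_div_iff₀ (by positivity) (by positivity)]
      linarith
    calc _ = ((2*n+1)! : ℝ)^2 / (2^(m+1+j)*2^(m+1+i) * (2*i+1)! * (2*j+1)!) * (E / ((n ! : ℝ) * (m+1)!)) := by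
            field_simp
      _ ≤ ((2*n+1)! : ℝ)^2 / (2^(m+1+j)*2^(m+1+i) * (2*i+1)! * (2*j+1)!) * (1 / ((m+1+j)! * (m+1+i)!)) := by gcongr
      _ = _ := by field_simp
  refine le_trans ?_ (Finset.sum_le_sum term)
  rw [← Finset.mul_sum]
  have hsum : ∑ i ∈ range (k+2), (1 + ((i:ℝ)*((k:ℝ)+1-i))/n) * (((2*k+4).choose (2*i+1) : ℕ) : ℝ)
      = 2*4^(k+1) + (2*k+3)*k*4^k/n := by
    have h1 := odd_sum (k+1)
    have h2 := moment_sum k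
    rw [← h2, ← h1, Finset.sum_div, show 2*(k+1)+2 = 2*k+4 by ring, ← Finset.sum_add_distrib]
    refine Finset.sum_congr rfl fun i _ => ?_
    ring
  rw [hsum]
  have hP := P_bound m
  have hnr : (n:ℝ) = (m:ℝ)+1+((k:ℝ)+1) := by rw [hn]; push_cast; ring
  have key := poly_ineq ((k:ℝ)+1) ((m:ℝ)+1) _ (by linarith [(Nat.cast_nonneg k : (0:ℝ) ≤ k)]) (by linarith [(Nat.cast_nonneg m : (0:ℝ) ≤ m)]) hP
  rw [← hnr] at key
  have hn0 : (0:ℝ) < n := by rw [hnr]; positivity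
  have e1 : (2*4^(k+1) + (2*k+3)*k*4^k/n : ℝ) =
      2*4^(k+1)/(2*n+1) * ((1 + (2*((k:ℝ)+1)+1)*((k:ℝ)+1-1)/(8*n))*(2*n+1)) := by
    field_simp; ring
  rw [e1]
  calc _ = C * (2*4^(k+1)/(2*n+1) * (((k:ℝ)+1+1) * ((4:ℝ)^(m+1) * ((m+1)! : ℝ)^2 / ((2*(m+1))! : ℝ)))) := by
        have f1 : ((2*n+1)! : ℝ) = (2*n+1) * (2*n)! := by rw [Nat.factorial_succ]; push_cast; ring
        have f2 : ((2*k+4)! : ℝ) = (2*k+4) * (2*(k+1)+1)! := by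
          rw [show 2*k+4 = (2*(k+1)+1)+1 by ring, Nat.factorial_succ]; push_cast; ring
        rw [hC, f1, f2, show (4:ℝ) = 2^2 by norm_num, ← pow_mul, ← pow_mul,
          show (2:ℝ)^(2*(k+1)) = 2^(k+1)*2^(k+1) by rw [← pow_add]; congr 1; ring,
          show (2:ℝ)^(2*m+k+3) = 2^(2*(m+1)) * 2^(k+1) by rw [← pow_add]; congr 1; ring]
        field_simp
        ring
    _ ≤ _ := by gcongr

lemma tail_le (x : ℝ) (hx : 0 < x) : (∫ t in Set.Ioi x, Real.exp (-t^2/2)) ≤ √(2*π)/2 := by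
  have hint : Integrable (fun t : ℝ => Real.exp (-t^2/2)) := by
    have := integrable_exp_neg_mul_sq (show (0:ℝ) < 1/2 by norm_num)
    refine this.congr (Filter.Eventually.of_forall fun t => ?_)
    simp only; congr 1; ring
  have h0 := integral_gaussian_Ioi (1/2)
  have e : ∀ t : ℝ, Real.exp (-t^2/2) = Real.exp (-(1/2)*t^2) := fun t => by congr 1; ring
  rw [show 2*π = π/(1/2) by ring, ← h0]
  simp only [← e]
  exact setIntegral_mono_set hint.integrableOn (Filter.Eventually.of_forall fun t => (Real.exp_pos _).le)
    (Set.Ioi_subset_Ioi hx.le).eventuallyLE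

lemma pow_exp_tendsto (j : ℕ) : Filter.Tendsto (fun t : ℝ => t^j * Real.exp (-t^2/2)) Filter.atTop (nhds 0) := by
  have h1 := rpow_mul_exp_neg_mul_sq_isLittleO_exp_neg (show (0:ℝ) < 1/2 by norm_num) (j:ℝ)
  have h2 : Filter.Tendsto (fun t : ℝ => Real.exp (-(1/2)*t)) Filter.atTop (nhds 0) :=
    Real.tendsto_exp_atBot.comp (Filter.tendsto_id.const_mul_atTop_of_neg (by norm_num))
  refine (h1.trans_tendsto h2).congr fun t => ?_
  rw [Real.rpow_natCast]; congr 2; ring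

lemma err_bound (n : ℕ) (x : ℝ) (hx : 0 < x) :
    hp n x / gp n x * Real.exp (-x^2/2) - (∫ t in Set.Ioi x, Real.exp (-t^2/2))
      ≤ ((2*n+1)! : ℝ) / gp n x^2 * (√(2*π)/2) := by
  have hint : Integrable (fun t : ℝ => Real.exp (-t^2/2)) := by
    have := integrable_exp_neg_mul_sq (show (0:ℝ) < 1/2 by norm_num)
    refine this.congr (Filter.Eventually.of_forall fun t => ?_)
    simp only; congr 1; ring
  set c := ((2*n+1)! : ℝ) / gp n x^2 with hc
  have hgx := gp_pos n x hx
  have hc0 : 0 ≤ c := by positivity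
  let f : ℝ → ℝ := fun t => hp n t / gp n t * Real.exp (-t^2/2)
  let f' : ℝ → ℝ := fun t => -(1 + ((2*n+1)! : ℝ) / gp n t^2) * Real.exp (-t^2/2)
  have hd : ∀ t ∈ Set.Ici x, HasDerivAt f (f' t) t := by
    intro t ht
    have htp : 0 < t := lt_of_lt_of_le hx ht
    have hg := gp_pos n t htp
    have he : HasDerivAt (fun t : ℝ => Real.exp (-t^2/2)) (Real.exp (-t^2/2) * (-t)) t := by
      refine HasDerivAt.exp ?_
      exact (((hasDerivAt_pow 2 t).fun_neg).div_const 2).congr_deriv (by simp; ring)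
    refine (((hasDeriv_h n t).fun_div (hasDeriv_g n t) hg.ne').fun_mul he).congr_deriv ?_
    have w := wronsk n t
    have w' : ((2*n+1)! : ℝ) = -(gp n t^2 + hd n t * gp n t - hp n t * gd n t - t * hp n t * gp n t) := by linarith
    simp only [f']
    rw [w']
    field_simp
    ring
  have hneg : ∀ t ∈ Set.Ioi x, f' t ≤ 0 := by
    intro t ht
    have : 0 ≤ (1 + ((2*n+1)! : ℝ) / gp n t^2) * Real.exp (-t^2/2) := by positivity
    simp only [f']; linarith
  have hlim : Filter.Tendsto f Filter.atTop (nhds 0) := by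
    have hpl : Filter.Tendsto (fun t => hp n t * Real.exp (-t^2/2)) Filter.atTop (nhds 0) := by
      have := tendsto_finsetSum (range (n+1)) (fun i _ => (pow_exp_tendsto (2*i)).const_mul (_root_.hc n i))
      simp only [mul_zero, Finset.sum_const_zero] at this
      refine this.congr fun t => ?_
      rw [hp_eq, Finset.sum_mul]
      refine Finset.sum_congr rfl fun i _ => ?_
      ring
    have hpl2 := hpl.mul_const (1/gp n x)
    rw [zero_mul] at hpl2
    have hh : ∀ t, 0 ≤ hp n t := by
      intro t
      rw [hp_eq]
      refine Finset.sum_nonneg fun i _ => ?_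
      rw [pow_mul]
      unfold _root_.hc
      positivity
    refine tendsto_of_tendsto_of_tendsto_of_le_of_le' tendsto_const_nhds hpl2 ?_ ?_
    · filter_upwards [Filter.eventually_ge_atTop x] with t ht
      have hg := gp_pos n t (hx.trans_le ht)
      have := hh t
      simp only [f]; positivity
    · filter_upwards [Filter.eventually_ge_atTop x] with t ht
      have hg := gp_mono n x t hx ht
      have := hh t
      calc f t = hp n t * Real.exp (-t^2/2) * (1/gp n t) := by simp only [f]; ring
        _ ≤ _ := by gcongr
  have hI := integral_Ioi_of_hasDerivAt_of_nonpos' hd hneg hlim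
  have hIi := integrableOn_Ioi_deriv_of_nonpos' hd hneg hlim
  have hmono : ∫ t in Set.Ioi x, (-(1+c)) * Real.exp (-t^2/2) ≤ ∫ t in Set.Ioi x, f' t := by
    refine setIntegral_mono_on (hint.integrableOn.const_mul _) hIi measurableSet_Ioi fun t ht => ?_
    have hg := gp_mono n x t hx (le_of_lt ht)
    simp only [f']
    have : ((2*n+1)! : ℝ) / gp n t^2 ≤ c := by rw [hc]; gcongr
    refine mul_le_mul_of_nonneg_right (by linarith) (Real.exp_pos _).le
  rw [integral_const_mul, hI] at hmono
  have ht := mul_le_mul_of_nonneg_left (tail_le x hx) hc0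
  simp only [f] at hmono
  linarith

theorem stmt15 (n : ℕ) (hn : 1 ≤ n) (x : ℝ) (hx : 0 < x)
    (k : ℕ) (hk1 : 1 ≤ k) (hk2 : k ≤ n - 1) :
    hp n x / gp n x * Real.exp (-x^2/2) - (∫ t in Set.Ioi x, Real.exp (-t^2/2))
      < Real.sqrt (2*Real.pi) * (2*k+1)! * (2*(n-k)-1)! * n !
        / (2^k * x^(2*(k+1)) * (2*n)! * (n-k-1)!) := by
  refine (err_bound n x hx).trans_lt ?_
  have hs := gp_sq n hn x hx k (by omega)
  obtain ⟨k, rfl⟩ : ∃ k', k = k'+1 := ⟨k-1, by omega⟩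
  obtain ⟨m, rfl⟩ : ∃ m, n = m+1+(k+1) := ⟨n-k-2, by omega⟩
  have hcf := coef_bound k m
  rw [show m+1+(k+1)-(k+1)-1 = m by omega, show 2*(m+1+(k+1)-(k+1))-1 = 2*m+1 by omega]
  set n := m+1+(k+1)
  set K := k+1
  set G := ∑ i ∈ range (K+1), gc n i * gc n (K-i)
  have f1 : ((m+1)! : ℝ) = (m+1) * m ! := by rw [Nat.factorial_succ]; push_cast; ring
  have f2 : ((2*(m+1))! : ℝ) = 2*(m+1) * (2*m+1)! := by
    rw [show 2*(m+1) = (2*m+1)+1 by ring, Nat.factorial_succ]; push_cast; ring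
  set L := ((2*n+1)! : ℝ) * 2^K * (2*n)! * (m+1)! / ((2*K+1)! * n ! * (2*(m+1))!) with hL
  have hL0 : 0 < L := by positivity
  have hlt : L * x^(2*(K+1)) < gp n x^2 := by
    refine lt_of_le_of_lt ?_ hs
    gcongr
  have hsq : 0 < √(2*π) := by positivity
  calc ((2*n+1)! : ℝ) / gp n x^2 * (√(2*π)/2) < ((2*n+1)! : ℝ) / (L * x^(2*(K+1))) * (√(2*π)/2) := by gcongr
    _ = _ := by
      rw [hL, f1, f2]
      field_simp
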